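/- There is no anonymous, neutral, sd-efficient, and sd-strategyproof social decision scheme that extends random dictatorship to the full domain of weak preferences when there are n ≥ 4 agents and m ≥ 4 alternatives. -/

import Mathlib

open Finset
open scoped Classical

section Framework

variable {A : Type*} [Fintype A] {n : ℕ}

/-- `p` is a lottery (probability distribution) on the set of alternatives `A`. -/
def IsLottery (p : A → ℝ) : Prop := (∀ x, 0 ≤ p x) ∧ ∑ x, p x = 1

/-- `r` is a weak preference relation: complete (total) and transitive. -/
def IsPref (r : A → A → Prop) : Prop := Total r ∧ Transitive r

/-- A preference profile assigns a weak preference relation to each of the `n` agents. -/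
def IsProfile (R : Fin n → A → A → Prop) : Prop := ∀ i, IsPref (R i)

/-- The probability that `p` assigns to alternatives weakly preferred (by `r`) to `x`. -/
noncomputable def upperProb (r : A → A → Prop) (p : A → ℝ) (x : A) : ℝ :=
  ∑ y ∈ univ.filter (fun y => r y x), p y

/-- Stochastic dominance: `p ≽^sd q` w.r.t. the preference relation `r`. -/
def SDge (r : A → A → Prop) (p q : A → ℝ) : Prop :=
  ∀ x, upperProb r q x ≤ upperProb r p x

/-- Strict stochastic dominance: `p ≻^sd q` w.r.t. the preference relation `r`. -/
def SDgt (r : A → A → Prop) (p q : A → ℝ) : Prop :=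
  SDge r p q ∧ ¬ SDge r q p

/-- A social decision scheme maps every preference profile to a lottery. -/
def IsSDS (f : (Fin n → A → A → Prop) → (A → ℝ)) : Prop :=
  ∀ R : Fin n → A → A → Prop, IsProfile R → IsLottery (f R)

/-- Anonymity: invariance under permutations of the agents. -/
def Anonymous (f : (Fin n → A → A → Prop) → (A → ℝ)) : Prop :=
  ∀ R : Fin n → A → A → Prop, IsProfile R → ∀ π : Equiv.Perm (Fin n),
    f (fun i => R (π i)) = f R

/-- Neutrality: `f(R^σ)(σ x) = f(R)(x)`, where `R^σ` relabels alternatives by `σ`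
(i.e. `σ x ≽^σ_i σ y ↔ x ≽_i y`). -/
def Neutral (f : (Fin n → A → A → Prop) → (A → ℝ)) : Prop :=
  ∀ R : Fin n → A → A → Prop, IsProfile R → ∀ σ : Equiv.Perm A, ∀ x : A,
    f (fun i u v => R i (σ.symm u) (σ.symm v)) (σ x) = f R x

/-- The lottery `p` is sd-efficient for the profile `R`: no lottery `q` is weakly
sd-preferred to `p` by all agents and strictly sd-preferred by some agent. -/
def SDEfficientLottery (R : Fin n → A → A → Prop) (p : A → ℝ) : Prop :=
  ¬ ∃ q : A → ℝ, IsLottery q ∧ (∀ i, SDge (R i) q p) ∧ (∃ i, SDgt (R i) q p)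

/-- sd-efficiency of a social decision scheme. -/
def SDEfficient (f : (Fin n → A → A → Prop) → (A → ℝ)) : Prop :=
  ∀ R : Fin n → A → A → Prop, IsProfile R → SDEfficientLottery R (f R)

/-- sd-strategyproofness: no agent can misreport and obtain a strictly
sd-preferred lottery. -/
def SDStrategyproof (f : (Fin n → A → A → Prop) → (A → ℝ)) : Prop :=
  ∀ R R' : Fin n → A → A → Prop, IsProfile R → IsProfile R' → ∀ i : Fin n,
    (∀ j, j ≠ i → R j = R' j) → ¬ SDgt (R i) (f R') (f R)

/-- `x` is the unique most-preferred alternative of the relation `r`. -/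
def UniqueTop (r : A → A → Prop) (x : A) : Prop :=
  ∀ y, y ≠ x → r x y ∧ ¬ r y x

/-- `f` extends random dictatorship: whenever every agent has a unique top choice,
each alternative gets probability (number of agents having it as top)/n. -/
def ExtendsRD (f : (Fin n → A → A → Prop) → (A → ℝ)) : Prop :=
  ∀ R : Fin n → A → A → Prop, IsProfile R →
    ∀ t : Fin n → A, (∀ i, UniqueTop (R i) (t i)) →
      ∀ x : A, f R x = ((univ.filter (fun i => t i = x)).card : ℝ) / (n : ℝ)

/-- `x` is Pareto-dominated in the profile `R`. -/
def Pareto_Dominated (R : Fin n → A → A → Prop) (x : A) : Prop :=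
  ∃ y : A, (∀ i, R i y x) ∧ ∃ i, R i y x ∧ ¬ R i x y

end Framework

/-! ### Reduction to four agents and four alternatives -/

section Reduction

/-- The sum of `p` over a list, without a trailing zero when the list is nonempty. -/
def listSum (p : Fin 4 → ℝ) : List (Fin 4) → ℝ
  | [] => 0
  | x :: l => l.foldl (fun s y => s + p y) (p x)

lemma listSum_eq (p : Fin 4 → ℝ) (l : List (Fin 4)) : listSum p l = (l.map p).sum := by
  have foldl_eq : ∀ (l : List (Fin 4)) (c : ℝ),
      l.foldl (fun s y => s + p y) c = c + (l.map p).sum := by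
    intro l
    induction l with
    | nil => simp
    | cons y l ih => intro c; simp [ih, add_assoc]
  cases l with
  | nil => rfl
  | cons x l => simp [listSum, foldl_eq]

/-- The probability that `p` assigns to the alternatives whose rank in `r` is at most `t`. -/
def levelProb (r : Fin 4 → ℕ) (p : Fin 4 → ℝ) (t : ℕ) : ℝ :=
  listSum p (List.filter (fun x => Nat.ble (r x) t) [0, 1, 2, 3])

lemma levelProb_eq (r : Fin 4 → ℕ) (p : Fin 4 → ℝ) (t : ℕ) :
    levelProb r p t = ∑ x, if r x ≤ t then p x else 0 := by
  rw [levelProb, listSum_eq, Fin.sum_univ_four]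
  have h : ∀ x, Nat.ble (r x) t = decide (r x ≤ t) := fun x => by
    rw [Bool.eq_iff_iff]; simp
  simp only [h]
  by_cases h0 : r 0 ≤ t <;> by_cases h1 : r 1 ≤ t <;> by_cases h2 : r 2 ≤ t <;>
    by_cases h3 : r 3 ≤ t <;> simp [h0, h1, h2, h3] <;> ring

/-- Renaming the alternatives by `σ` turns the preferences `R` of all agents other than `a` into
those of `R'`, agent `i` being matched with agent `π i`. The ranks used by agent `a` in `R` are
exactly `0, …, m`. -/
abbrev IsDeviation (R R' : Fin 4 → Fin 4 → ℕ) (a : Fin 4) (π σ : Fin 4 → Fin 4) (m : ℕ) : Prop :=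
  Function.Injective π ∧ Function.Injective σ ∧ (∀ i, i ≠ a → ∀ x, R i (σ x) = R' (π i) x) ∧
    (∀ x, R a x ≤ m) ∧ ∀ t ≤ m, ∃ x, R a x = t

/-- The properties of a social decision scheme for four agents and four alternatives, with
preferences given by ranks (a smaller rank is better). -/
structure IsGoodScheme (g : (Fin 4 → Fin 4 → ℕ) → Fin 4 → ℝ) : Prop where
  nonneg : ∀ R x, 0 ≤ g R x
  sum_eq : ∀ R, g R 0 + g R 1 + g R 2 + g R 3 = 1
  rename : ∀ R R' : Fin 4 → Fin 4 → ℕ, ∀ π σ : Fin 4 → Fin 4, Function.Injective π →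
    Function.Injective σ → (∀ i x, R i (σ x) = R' (π i) x) → ∀ x, g R (σ x) = g R' x
  efficient : ∀ R : Fin 4 → Fin 4 → ℕ, ∀ v : Fin 4 → ℝ, ∑ x, v x = 0 →
    (∀ i k, 0 ≤ ∑ x, if R i x ≤ R i k then v x else 0) →
    (∃ i k, 0 < ∑ x, if R i x ≤ R i k then v x else 0) → ∃ x, v x < 0 ∧ g R x = 0
  strategyproof : ∀ R R' : Fin 4 → Fin 4 → ℕ, ∀ a, (∀ i, i ≠ a → R i = R' i) →
    (∀ k, levelProb (R a) (g R) (R a k) ≤ levelProb (R a) (g R') (R a k)) →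
    ∀ k, levelProb (R a) (g R') (R a k) ≤ levelProb (R a) (g R) (R a k)

lemma sum_ite_single (P : Fin 4 → Prop) [DecidablePred P] (w : Fin 4) :
    (∑ u, if P u then (Pi.single w 1 : Fin 4 → ℝ) u else 0) = if P w then 1 else 0 := by
  rw [Finset.sum_eq_single w]
  · simp
  · intro u _ hu
    simp [hu]
  · simp

namespace IsGoodScheme

variable {g : (Fin 4 → Fin 4 → ℕ) → Fin 4 → ℝ}

lemma eq_zero_of_dominated (hg : IsGoodScheme g) (R : Fin 4 → Fin 4 → ℕ) (y x : Fin 4)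
    (h : (∀ i, R i y ≤ R i x) ∧ ∃ i, R i y < R i x) : g R x = 0 := by
  obtain ⟨hle, j, hj⟩ := h
  have key : ∀ (i k : Fin 4),
      (∑ z, if R i z ≤ R i k then (Pi.single y 1 - Pi.single x 1 : Fin 4 → ℝ) z else 0) =
        (if R i y ≤ R i k then (1 : ℝ) else 0) - (if R i x ≤ R i k then 1 else 0) := by
    intro i k
    have hsum := sum_ite_single fun z => R i z ≤ R i k
    rw [← hsum y, ← hsum x, ← Finset.sum_sub_distrib]
    refine Finset.sum_congr rfl fun z _ => ?_
    split_ifs <;> simp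
  obtain ⟨z, hz, hz'⟩ := hg.efficient R (Pi.single y 1 - Pi.single x 1) (by simp) (by
      intro i k
      rw [key]
      have := hle i
      split_ifs <;> first | omega | norm_num) ⟨j, y, by
      rw [key, if_pos le_rfl, if_neg hj.not_ge]
      norm_num⟩
  rcases eq_or_ne z x with rfl | hzx
  · exact hz'
  · exfalso
    rcases eq_or_ne z y with rfl | hzy
    · simp [hzx] at hz; linarith
    · simp [hzx, hzy] at hz

/-- Probability on `x` and `y` can be moved to `w` and `z` to the benefit of all agents. -/
lemma eq_zero_or_eq_zero (hg : IsGoodScheme g) (R : Fin 4 → Fin 4 → ℕ) (w x y z : Fin 4)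
    (h : (∀ i k, ([x, y].filter fun u => R i u ≤ R i k).length ≤
        ([w, z].filter fun u => R i u ≤ R i k).length) ∧
      ∃ i k, ([x, y].filter fun u => R i u ≤ R i k).length <
        ([w, z].filter fun u => R i u ≤ R i k).length) : g R x = 0 ∨ g R y = 0 := by
  obtain ⟨hle, j, l, hlt⟩ := h
  have key : ∀ (i k : Fin 4),
      (∑ u, if R i u ≤ R i k then ((Pi.single w 1 + Pi.single z 1) -
        (Pi.single x 1 + Pi.single y 1) : Fin 4 → ℝ) u else 0) =
        (([w, z].filter fun u => R i u ≤ R i k).length : ℝ) -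
          (([x, y].filter fun u => R i u ≤ R i k).length : ℝ) := by
    intro i k
    trans ((if R i w ≤ R i k then (1 : ℝ) else 0) + (if R i z ≤ R i k then 1 else 0)) -
      ((if R i x ≤ R i k then 1 else 0) + (if R i y ≤ R i k then 1 else 0))
    · have hsum := sum_ite_single fun z => R i z ≤ R i k
      rw [← hsum w, ← hsum x, ← hsum y, ← hsum z]
      simp only [← Finset.sum_add_distrib, ← Finset.sum_sub_distrib]
      refine Finset.sum_congr rfl fun u _ => ?_
      split_ifs <;> simp
    · simp only [List.filter_cons, List.filter_nil, decide_eq_true_eq]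
      split_ifs <;> norm_num
  obtain ⟨u, hu, hu'⟩ := hg.efficient R
    ((Pi.single w 1 + Pi.single z 1) - (Pi.single x 1 + Pi.single y 1))
    (by simp [Finset.sum_add_distrib]) (by
      intro i k
      rw [key, sub_nonneg]
      exact_mod_cast hle i k) ⟨j, l, by
      rw [key, sub_pos]
      exact_mod_cast hlt⟩
  rcases eq_or_ne u x with rfl | hux
  · exact Or.inl hu'
  rcases eq_or_ne u y with rfl | huy
  · exact Or.inr hu'
  exfalso
  simp only [Pi.sub_apply, Pi.add_apply, Pi.single_apply, hux, huy, if_false] at hu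
  split_ifs at hu <;> norm_num at hu

lemma apply_symm (hg : IsGoodScheme g) (R : Fin 4 → Fin 4 → ℕ) (π σ : Fin 4 → Fin 4) (x : Fin 4)
    (h : Function.Injective π ∧ Function.Injective σ ∧ ∀ i x, R i (σ x) = R (π i) x) :
    g R (σ x) = g R x :=
  hg.rename R R π σ h.1 h.2.1 h.2.2 x

lemma levelProb_of_le (hg : IsGoodScheme g) (R : Fin 4 → Fin 4 → ℕ) {r : Fin 4 → ℕ} {t : ℕ}
    (h : ∀ x, r x ≤ t) : levelProb r (g R) t = 1 := by
  rw [levelProb_eq, ← hg.sum_eq R, Fin.sum_univ_four]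
  simp [h]

lemma deviation (hg : IsGoodScheme g) {R R' : Fin 4 → Fin 4 → ℕ} {a : Fin 4}
    {π σ : Fin 4 → Fin 4} {m : ℕ} (h : IsDeviation R R' a π σ m) :
    (∃ t < m, levelProb (R a ∘ σ) (g R') t < levelProb (R a) (g R) t) ∨
      ∀ t < m, levelProb (R a ∘ σ) (g R') t = levelProb (R a) (g R) t := by
  obtain ⟨hπ, hσ, hR, hm, hsurj⟩ := h
  let s : Equiv.Perm (Fin 4) := Equiv.ofBijective σ (Finite.injective_iff_bijective.1 hσ)
  have hs : ∀ x, s x = σ x := fun x => rfl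
  set Q : Fin 4 → Fin 4 → ℕ := fun i x => R' (π i) (s.symm x) with hQ
  have hren := hg.rename Q R' π σ hπ hσ (fun i x => by simp [hQ, ← hs])
  have hlev : ∀ t, levelProb (R a ∘ σ) (g R') t = levelProb (R a) (g Q) t := by
    intro t
    rw [levelProb_eq, levelProb_eq,
      ← Equiv.sum_comp s fun x => if R a x ≤ t then g Q x else 0]
    simp [hs, hren]
  simp only [hlev]
  by_contra! hcon
  obtain ⟨hle, t, ht, hne⟩ := hcon
  have := hg.strategyproof R Q a (fun i hi => by
    funext x
    simp [hQ, ← hR i hi, ← hs]) (fun k => by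
      rcases (hm k).lt_or_eq with hk | hk
      · exact hle _ hk
      · rw [hk, hg.levelProb_of_le _ hm, hg.levelProb_of_le _ hm])
  obtain ⟨k, rfl⟩ := hsurj t ht.le
  exact hne (le_antisymm (this k) (hle _ ht))

lemma deviation_two (hg : IsGoodScheme g) (R R' : Fin 4 → Fin 4 → ℕ) (a : Fin 4)
    (π σ : Fin 4 → Fin 4) (h : IsDeviation R R' a π σ 1) :
    levelProb (R a ∘ σ) (g R') 0 ≤ levelProb (R a) (g R) 0 := by
  rcases hg.deviation h with ⟨t, ht, h'⟩ | h'
  · interval_cases t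
    exact h'.le
  · exact (h' 0 (by norm_num)).le

lemma deviation_three (hg : IsGoodScheme g) (R R' : Fin 4 → Fin 4 → ℕ) (a : Fin 4)
    (π σ : Fin 4 → Fin 4) (h : IsDeviation R R' a π σ 2) :
    levelProb (R a ∘ σ) (g R') 0 < levelProb (R a) (g R) 0 ∨
    levelProb (R a ∘ σ) (g R') 1 < levelProb (R a) (g R) 1 ∨
    levelProb (R a ∘ σ) (g R') 0 = levelProb (R a) (g R) 0 ∧
      levelProb (R a ∘ σ) (g R') 1 = levelProb (R a) (g R) 1 := by
  rcases hg.deviation h with ⟨t, ht, h'⟩ | h'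
  · interval_cases t <;> tauto
  · exact Or.inr (Or.inr ⟨h' 0 (by norm_num), h' 1 (by norm_num)⟩)

lemma deviation_four (hg : IsGoodScheme g) (R R' : Fin 4 → Fin 4 → ℕ) (a : Fin 4)
    (π σ : Fin 4 → Fin 4) (h : IsDeviation R R' a π σ 3) :
    levelProb (R a ∘ σ) (g R') 0 < levelProb (R a) (g R) 0 ∨
    levelProb (R a ∘ σ) (g R') 1 < levelProb (R a) (g R) 1 ∨
    levelProb (R a ∘ σ) (g R') 2 < levelProb (R a) (g R) 2 ∨
    levelProb (R a ∘ σ) (g R') 0 = levelProb (R a) (g R) 0 ∧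
      levelProb (R a ∘ σ) (g R') 1 = levelProb (R a) (g R) 1 ∧
      levelProb (R a ∘ σ) (g R') 2 = levelProb (R a) (g R) 2 := by
  rcases hg.deviation h with ⟨t, ht, h'⟩ | h'
  · interval_cases t <;> tauto
  · exact Or.inr (Or.inr (Or.inr ⟨h' 0 (by norm_num), h' 1 (by norm_num), h' 2 (by norm_num)⟩))

end IsGoodScheme

end Reduction

section Embedding

variable {A : Type*} {n : ℕ}

/-- Extension of a rank function on four alternatives to all alternatives, the others being
ranked last. -/
noncomputable def extendRank (e : Fin 4 ↪ A) (r : Fin 4 → ℕ) : A → ℕ∞ :=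
  Function.extend e (fun k => (r k : ℕ∞)) ⊤

/-- Extension of preferences of four agents over four alternatives to all agents and
alternatives: further agents are indifferent between the four alternatives, and all agents are
indifferent between the further alternatives, which are ranked last. -/
def extendProfile (ι : Fin 4 ↪ Fin n) (e : Fin 4 ↪ A) (R : Fin 4 → Fin 4 → ℕ) :
    Fin n → A → A → Prop :=
  fun i x y => extendRank e (Function.extend ι R 0 i) x ≤ extendRank e (Function.extend ι R 0 i) y

lemma extendRank_apply (e : Fin 4 ↪ A) (r : Fin 4 → ℕ) (k : Fin 4) :
    extendRank e r (e k) = r k :=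
  e.injective.extend_apply _ _ k

lemma extendRank_of_notMem (e : Fin 4 ↪ A) (r : Fin 4 → ℕ) {x : A} (hx : ∀ k, e k ≠ x) :
    extendRank e r x = ⊤ :=
  Function.extend_apply' _ _ _ fun ⟨k, hk⟩ => hx k hk

lemma isProfile_extendProfile (ι : Fin 4 ↪ Fin n) (e : Fin 4 ↪ A) (R : Fin 4 → Fin 4 → ℕ) :
    IsProfile (extendProfile ι e R) := by
  intro i
  constructor
  · intro x y
    exact le_total _ _
  · intro x y z
    exact le_trans

lemma extendRank_viaFintypeEmbedding (e : Fin 4 ↪ A) (r : Fin 4 → ℕ)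
    (s : Equiv.Perm (Fin 4)) (x : A) :
    extendRank e r (s.viaFintypeEmbedding e x) = extendRank e (r ∘ s) x := by
  by_cases hx : ∃ k, e k = x
  · obtain ⟨k, rfl⟩ := hx
    rw [Equiv.Perm.viaFintypeEmbedding_apply_image, extendRank_apply, extendRank_apply]
    rfl
  · rw [Equiv.Perm.viaFintypeEmbedding_apply_notMem_range _ _ hx]
    push Not at hx
    rw [extendRank_of_notMem e _ hx, extendRank_of_notMem e _ hx]

lemma extend_viaFintypeEmbedding (ι : Fin 4 ↪ Fin n) (R : Fin 4 → Fin 4 → ℕ)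
    (s : Equiv.Perm (Fin 4)) (i : Fin n) :
    Function.extend ι R 0 (s.viaFintypeEmbedding ι i) = Function.extend ι (R ∘ s) 0 i := by
  by_cases hi : ∃ k, ι k = i
  · obtain ⟨k, rfl⟩ := hi
    rw [Equiv.Perm.viaFintypeEmbedding_apply_image, ι.injective.extend_apply,
      ι.injective.extend_apply]
    rfl
  · rw [Equiv.Perm.viaFintypeEmbedding_apply_notMem_range _ _ hi, Function.extend_apply' _ _ _ hi,
      Function.extend_apply' _ _ _ hi]

lemma extend_comp_right (ι : Fin 4 ↪ Fin n) (R : Fin 4 → Fin 4 → ℕ)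
    (s : Fin 4 → Fin 4) (i : Fin n) :
    Function.extend ι R 0 i ∘ s = Function.extend ι (fun j => R j ∘ s) 0 i := by
  by_cases hi : ∃ k, ι k = i
  · obtain ⟨k, rfl⟩ := hi
    rw [ι.injective.extend_apply, ι.injective.extend_apply]
  · rw [Function.extend_apply' _ _ _ hi, Function.extend_apply' _ _ _ hi]
    rfl

variable [Fintype A]

lemma upperProb_apply (e : Fin 4 ↪ A) (r : Fin 4 → ℕ) (p : A → ℝ) (k : Fin 4) :
    upperProb (fun x y => extendRank e r x ≤ extendRank e r y) p (e k) =
      ∑ j, if r j ≤ r k then p (e j) else 0 := by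
  rw [upperProb, ← Finset.sum_filter]
  symm
  refine Finset.sum_bij (fun j _ => e j) ?_ ?_ ?_ fun _ _ => rfl
  · intro j hj
    simpa [extendRank_apply] using hj
  · intro _ _ _ _ h
    exact e.injective h
  · intro x hx
    by_cases hx' : ∃ j, e j = x
    · obtain ⟨j, rfl⟩ := hx'
      exact ⟨j, by simpa [extendRank_apply] using hx, rfl⟩
    · push Not at hx'
      simp [extendRank_of_notMem e r hx', extendRank_apply] at hx

lemma upperProb_of_notMem (e : Fin 4 ↪ A) (r : Fin 4 → ℕ) (p : A → ℝ) {x : A}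
    (hx : ∀ k, e k ≠ x) :
    upperProb (fun x y => extendRank e r x ≤ extendRank e r y) p x = ∑ y, p y := by
  simp [upperProb, extendRank_of_notMem e r hx]

lemma sdge_iff (e : Fin 4 ↪ A) (r : Fin 4 → ℕ) {p q : A → ℝ} (hp : IsLottery p)
    (hq : IsLottery q) :
    SDge (fun x y => extendRank e r x ≤ extendRank e r y) p q ↔
      ∀ k, (∑ j, if r j ≤ r k then q (e j) else 0) ≤ ∑ j, if r j ≤ r k then p (e j) else 0 := by
  refine ⟨fun h k => ?_, fun h x => ?_⟩
  · rw [← upperProb_apply, ← upperProb_apply]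
    exact h _
  · by_cases hx : ∃ k, e k = x
    · obtain ⟨k, rfl⟩ := hx
      rw [upperProb_apply, upperProb_apply]
      exact h k
    · push Not at hx
      rw [upperProb_of_notMem e r p hx, upperProb_of_notMem e r q hx, hp.2, hq.2]

/-- A direction that benefits everyone cannot be followed from an efficient lottery. -/
lemma SDEfficientLottery.exists_add_neg {R : Fin n → A → A → Prop} {p : A → ℝ}
    (h : SDEfficientLottery R p) (hp : IsLottery p) (w : A → ℝ) (hw : ∑ x, w x = 0)
    (hle : ∀ i x, 0 ≤ upperProb (R i) w x) (hlt : ∃ i x, 0 < upperProb (R i) w x) :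
    ∃ x, p x + w x < 0 := by
  by_contra! hcon
  have hadd : ∀ i x, upperProb (R i) (fun x => p x + w x) x =
      upperProb (R i) p x + upperProb (R i) w x := fun i x => Finset.sum_add_distrib
  have hge : ∀ i, SDge (R i) (fun x => p x + w x) p := fun i x => by
    rw [hadd]
    linarith [hle i x]
  obtain ⟨i, x, hi⟩ := hlt
  refine h ⟨fun x => p x + w x, ⟨hcon, by rw [Finset.sum_add_distrib, hp.2, hw, add_zero]⟩, hge,
    i, hge i, fun hle' => ?_⟩
  have := hle' x
  rw [hadd] at this
  linarith

lemma exists_add_smul_nonneg {α : Type*} [Finite α] (p v : α → ℝ)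
    (h : ∀ x, 0 ≤ p x) (hv : ∀ x, v x < 0 → p x ≠ 0) : ∃ c > 0, ∀ x, 0 ≤ p x + c * v x := by
  cases nonempty_fintype α
  have hev : ∀ᶠ c in nhdsWithin (0 : ℝ) (Set.Ioi 0), ∀ x, 0 ≤ p x + c * v x := by
    rw [Filter.eventually_all]
    intro x
    rcases le_or_gt 0 (v x) with hx | hx
    · filter_upwards [self_mem_nhdsWithin] with c hc
      have := mul_nonneg (le_of_lt hc) hx
      linarith [h x]
    · have hpos : 0 < p x := lt_of_le_of_ne (h x) (hv x hx).symm
      have hcont : Continuous fun c : ℝ => p x + c * v x := by fun_prop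
      have : ∀ᶠ c in nhds (0 : ℝ), 0 < p x + c * v x :=
        hcont.continuousAt.eventually_const_lt (by simpa using hpos)
      filter_upwards [nhdsWithin_le_nhds this] with c hc using hc.le
  obtain ⟨c, hc, hc'⟩ := (hev.and self_mem_nhdsWithin).exists
  exact ⟨c, hc', hc⟩

variable (ι : Fin 4 ↪ Fin n) (e : Fin 4 ↪ A) (R : Fin 4 → Fin 4 → ℕ)

lemma SDEfficientLottery.eq_zero_of_notMem {p : A → ℝ}
    (h : SDEfficientLottery (extendProfile ι e R) p) (hp : IsLottery p) {x : A}
    (hx : ∀ k, e k ≠ x) : p x = 0 := by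
  by_contra hne
  have hup : ∀ r : Fin 4 → ℕ, ∀ y, upperProb (fun u v => extendRank e r u ≤ extendRank e r v)
      (fun y => p x * ((Pi.single (e 0) 1 : A → ℝ) y - (Pi.single x 1 : A → ℝ) y)) y =
      p x * ((if extendRank e r (e 0) ≤ extendRank e r y then 1 else 0) -
        if extendRank e r x ≤ extendRank e r y then 1 else 0) := by
    intro r y
    rw [upperProb, ← Finset.mul_sum, Finset.sum_sub_distrib]
    simp [Pi.single_apply]
  have hpos : 0 < p x := lt_of_le_of_ne (hp.1 x) (Ne.symm hne)
  obtain ⟨y, hy⟩ := h.exists_add_neg hp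
    (fun y => p x * ((Pi.single (e 0) 1 : A → ℝ) y - (Pi.single x 1 : A → ℝ) y))
    (by rw [← Finset.mul_sum, Finset.sum_sub_distrib]; simp)
    (fun i y => by
      unfold extendProfile
      rw [hup]
      refine mul_nonneg hpos.le ?_
      rw [extendRank_of_notMem e _ hx]
      by_cases hy : extendRank e (Function.extend ι R 0 i) y = ⊤
      · simp [hy]
      · simp only [top_le_iff, hy, if_false]
        split_ifs <;> norm_num)
    ⟨ι 0, e 0, by
      unfold extendProfile
      rw [hup, extendRank_of_notMem e _ hx, extendRank_apply]
      simpa using hpos⟩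
  rcases eq_or_ne y x with rfl | hyx
  · simp [(hx 0).symm] at hy
  · have := hp.1 y
    rcases eq_or_ne y (e 0) with rfl | hy0
    · simp [hyx] at hy
      linarith
    · simp [hyx, hy0] at hy
      linarith

theorem isGoodScheme_extendProfile {f : (Fin n → A → A → Prop) → (A → ℝ)} (hf : IsSDS f)
    (hanon : Anonymous f) (hneut : Neutral f) (heff : SDEfficient f)
    (hsp : SDStrategyproof f) :
    IsGoodScheme fun R k => f (extendProfile ι e R) (e k) where
  nonneg R x := (hf _ (isProfile_extendProfile ι e R)).1 _
  sum_eq R := by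
    have hlot := hf _ (isProfile_extendProfile ι e R)
    rw [← hlot.2, ← Fin.sum_univ_four fun k => f (extendProfile ι e R) (e k)]
    refine Finset.sum_of_injOn e e.injective.injOn (by simp) (fun x _ hx => ?_) fun _ _ => rfl
    exact (heff _ (isProfile_extendProfile ι e R)).eq_zero_of_notMem ι e R hlot
      fun k hk => hx ⟨k, by simp, hk⟩
  rename R R' π σ hπ hσ h x := by
    let P : Equiv.Perm (Fin 4) := Equiv.ofBijective π (Finite.injective_iff_bijective.1 hπ)
    let S : Equiv.Perm (Fin 4) := Equiv.ofBijective σ (Finite.injective_iff_bijective.1 hσ)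
    have hR' := isProfile_extendProfile ι e R'
    have key : extendProfile ι e R = fun i u v => extendProfile ι e R'
        (P.viaFintypeEmbedding ι i) ((S.viaFintypeEmbedding e).symm u)
        ((S.viaFintypeEmbedding e).symm v) := by
      have hcomp : (R' ∘ P) = fun j => R j ∘ S := by
        funext i y
        exact (h i y).symm
      funext i u v
      obtain ⟨u, rfl⟩ := (S.viaFintypeEmbedding e).surjective u
      obtain ⟨v, rfl⟩ := (S.viaFintypeEmbedding e).surjective v
      simp only [extendProfile, Equiv.symm_apply_apply, extendRank_viaFintypeEmbedding,
        extend_viaFintypeEmbedding, hcomp, extend_comp_right]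
    have hx : e (σ x) = S.viaFintypeEmbedding e (e x) :=
      (Equiv.Perm.viaFintypeEmbedding_apply_image S e x).symm
    simp only [hx]
    rw [key, hneut (fun i => extendProfile ι e R' (P.viaFintypeEmbedding ι i))
      (fun i => hR' _), hanon _ hR']
  efficient R v hv hle hlt := by
    have hprof := isProfile_extendProfile ι e R
    have hlot := hf _ hprof
    by_contra! hcon
    obtain ⟨c, hc, hc'⟩ := exists_add_smul_nonneg (fun k => f (extendProfile ι e R) (e k)) v
      (fun k => hlot.1 _) hcon
    set w : A → ℝ := fun x => c * Function.extend e v 0 x with hw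
    have hwe : ∀ k, w (e k) = c * v k := fun k => by rw [hw]; simp [e.injective.extend_apply]
    have hw0 : ∀ x, (∀ k, e k ≠ x) → w x = 0 := fun x hx => by
      have := Function.extend_apply' (f := e) v (0 : A → ℝ) x fun ⟨k, hk⟩ => hx k hk
      simp [hw, this]
    have hsum : ∑ x, w x = 0 := by
      have hcv : ∑ k, c * v k = 0 := by rw [← Finset.mul_sum, hv, mul_zero]
      rw [← hcv]
      symm
      exact Finset.sum_of_injOn e e.injective.injOn (by simp)
        (fun x _ hx => hw0 x fun k hk => hx ⟨k, by simp, hk⟩) fun k _ => (hwe k).symm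
    have hup : ∀ r : Fin 4 → ℕ, ∀ k,
        upperProb (fun x y => extendRank e r x ≤ extendRank e r y) w (e k) =
          c * ∑ j, if r j ≤ r k then v j else 0 := by
      intro r k
      rw [upperProb_apply, Finset.mul_sum]
      simp only [hwe, mul_ite, mul_zero]
    obtain ⟨x, hx⟩ := (heff _ hprof).exists_add_neg hlot w hsum (by
      intro i x
      unfold extendProfile
      by_cases hx : ∃ k, e k = x
      · obtain ⟨k, rfl⟩ := hx
        rw [hup]
        refine mul_nonneg hc.le ?_
        by_cases hi : ∃ j, ι j = i
        · obtain ⟨j, rfl⟩ := hi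
          rw [ι.injective.extend_apply]
          exact hle j k
        · rw [Function.extend_apply' _ _ _ hi]
          simp [hv]
      · push Not at hx
        rw [upperProb_of_notMem e _ w hx, hsum]) (by
      obtain ⟨i, k, hik⟩ := hlt
      refine ⟨ι i, e k, ?_⟩
      unfold extendProfile
      rw [hup, ι.injective.extend_apply]
      exact mul_pos hc hik)
    by_cases hx' : ∃ k, e k = x
    · obtain ⟨k, rfl⟩ := hx'
      rw [hwe] at hx
      exact absurd (hc' k) (not_le.2 hx)
    · push Not at hx'
      rw [hw0 x hx', add_zero] at hx
      exact absurd (hlot.1 x) (not_le.2 hx)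
  strategyproof R R' a h hle := by
    have hprof := isProfile_extendProfile ι e R
    have hprof' := isProfile_extendProfile ι e R'
    have := hsp _ _ hprof hprof' (ι a) (fun j hj => by
      have : Function.extend ι R 0 j = Function.extend ι R' 0 j := by
        by_cases hj' : ∃ k, ι k = j
        · obtain ⟨k, rfl⟩ := hj'
          rw [ι.injective.extend_apply, ι.injective.extend_apply]
          exact h k fun hk => hj (by rw [hk])
        · rw [Function.extend_apply' _ _ _ hj', Function.extend_apply' _ _ _ hj']
      funext x y
      simp only [extendProfile, this])
    unfold SDgt at this
    simp only [levelProb_eq] at hle ⊢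
    have hrank : extendProfile ι e R (ι a) =
        fun x y => extendRank e (R a) x ≤ extendRank e (R a) y := by
      funext x y
      simp only [extendProfile, ι.injective.extend_apply]
    rw [hrank, sdge_iff e (R a) (hf _ hprof') (hf _ hprof),
      sdge_iff e (R a) (hf _ hprof) (hf _ hprof')] at this
    by_contra hcon
    exact this ⟨hle, hcon⟩

end Embedding

/-! ### Contradiction for four agents and four alternatives -/

namespace Impossibility

/-! The profiles of the proof: agent `i` ranks alternative `x` in `Rj` at position `Rj i x`. -/

def R1 : Fin 4 → Fin 4 → ℕ :=
  ![![0, 0, 1, 1], ![1, 1, 0, 0], ![1, 1, 2, 0], ![1, 2, 0, 2]]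

def R2 : Fin 4 → Fin 4 → ℕ :=
  ![![0, 0, 1, 1], ![0, 1, 1, 0], ![1, 1, 0, 2], ![2, 2, 1, 0]]

def R3 : Fin 4 → Fin 4 → ℕ :=
  ![![1, 1, 0, 0], ![0, 0, 1, 1], ![0, 2, 0, 1], ![1, 1, 2, 0]]

def R4 : Fin 4 → Fin 4 → ℕ :=
  ![![0, 0, 1, 1], ![1, 1, 0, 0], ![0, 1, 0, 1], ![2, 1, 3, 0]]

def R5 : Fin 4 → Fin 4 → ℕ :=
  ![![0, 0, 1, 1], ![1, 1, 0, 0], ![0, 3, 1, 2], ![1, 1, 2, 0]]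

def R6 : Fin 4 → Fin 4 → ℕ :=
  ![![0, 0, 1, 1], ![0, 1, 0, 1], ![1, 1, 2, 0], ![2, 2, 1, 0]]

def R7 : Fin 4 → Fin 4 → ℕ :=
  ![![0, 0, 1, 1], ![0, 2, 1, 0], ![2, 2, 1, 0], ![0, 0, 0, 1]]

def R8 : Fin 4 → Fin 4 → ℕ :=
  ![![0, 0, 1, 1], ![1, 1, 0, 0], ![0, 2, 0, 1], ![1, 0, 2, 0]]

def R9 : Fin 4 → Fin 4 → ℕ :=
  ![![0, 0, 1, 1], ![1, 1, 0, 0], ![1, 1, 2, 0], ![1, 2, 0, 3]]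

def R10 : Fin 4 → Fin 4 → ℕ :=
  ![![1, 1, 0, 0], ![0, 0, 1, 1], ![0, 2, 0, 1], ![0, 0, 1, 0]]

def R11 : Fin 4 → Fin 4 → ℕ :=
  ![![0, 0, 1, 1], ![2, 2, 1, 0], ![0, 0, 0, 1], ![0, 3, 2, 1]]

def R12 : Fin 4 → Fin 4 → ℕ :=
  ![![0, 0, 1, 1], ![1, 1, 0, 0], ![0, 3, 1, 2], ![0, 0, 1, 0]]

def R13 : Fin 4 → Fin 4 → ℕ :=
  ![![0, 0, 1, 1], ![1, 1, 0, 0], ![0, 1, 0, 1], ![1, 1, 2, 0]]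

def R14 : Fin 4 → Fin 4 → ℕ :=
  ![![0, 0, 1, 1], ![0, 1, 1, 0], ![0, 0, 0, 1], ![2, 2, 1, 0]]

def R15 : Fin 4 → Fin 4 → ℕ :=
  ![![1, 0, 2, 0], ![1, 0, 2, 2], ![0, 2, 1, 2], ![2, 2, 1, 0]]

def R16 : Fin 4 → Fin 4 → ℕ :=
  ![![0, 2, 1, 0], ![2, 2, 1, 0], ![1, 1, 0, 2], ![0, 1, 2, 2]]

def R17 : Fin 4 → Fin 4 → ℕ :=
  ![![0, 2, 0, 1], ![2, 2, 1, 0], ![1, 1, 2, 0], ![0, 1, 2, 2]]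

def R18 : Fin 4 → Fin 4 → ℕ :=
  ![![0, 0, 1, 1], ![1, 1, 0, 0], ![0, 1, 0, 1], ![0, 0, 1, 0]]

def R19 : Fin 4 → Fin 4 → ℕ :=
  ![![1, 1, 0, 0], ![2, 1, 3, 0], ![1, 2, 0, 2], ![1, 0, 2, 2]]

def R20 : Fin 4 → Fin 4 → ℕ :=
  ![![1, 1, 0, 0], ![1, 0, 2, 0], ![0, 1, 2, 2], ![0, 2, 1, 2]]

def R21 : Fin 4 → Fin 4 → ℕ :=
  ![![1, 0, 1, 0], ![1, 1, 0, 0], ![0, 1, 2, 2], ![0, 2, 1, 2]]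

def R22 : Fin 4 → Fin 4 → ℕ :=
  ![![1, 2, 0, 0], ![1, 0, 2, 0], ![0, 1, 2, 2], ![0, 2, 1, 2]]

def R23 : Fin 4 → Fin 4 → ℕ :=
  ![![0, 2, 0, 1], ![1, 0, 2, 0], ![0, 1, 2, 2], ![2, 2, 1, 0]]

def R24 : Fin 4 → Fin 4 → ℕ :=
  ![![1, 0, 2, 0], ![0, 2, 0, 1], ![2, 2, 0, 1], ![0, 0, 1, 2]]

def R25 : Fin 4 → Fin 4 → ℕ :=
  ![![0, 2, 0, 1], ![2, 2, 1, 0], ![1, 1, 2, 0], ![0, 0, 2, 1]]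

def R26 : Fin 4 → Fin 4 → ℕ :=
  ![![1, 1, 0, 0], ![0, 2, 0, 1], ![0, 1, 2, 2], ![1, 1, 2, 0]]

def R27 : Fin 4 → Fin 4 → ℕ :=
  ![![0, 2, 1, 0], ![0, 1, 2, 2], ![0, 0, 0, 1], ![2, 2, 1, 0]]

def R28 : Fin 4 → Fin 4 → ℕ :=
  ![![1, 1, 0, 0], ![0, 2, 0, 1], ![1, 0, 2, 0], ![0, 1, 2, 2]]

def R29 : Fin 4 → Fin 4 → ℕ :=
  ![![0, 1, 0, 1], ![1, 0, 1, 0], ![0, 1, 2, 2], ![2, 2, 0, 1]]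

def R30 : Fin 4 → Fin 4 → ℕ :=
  ![![1, 2, 0, 0], ![1, 0, 2, 0], ![0, 1, 2, 2], ![0, 1, 0, 2]]

def R31 : Fin 4 → Fin 4 → ℕ :=
  ![![0, 2, 1, 0], ![0, 0, 2, 1], ![0, 0, 0, 1], ![2, 2, 1, 0]]

def R32 : Fin 4 → Fin 4 → ℕ :=
  ![![1, 1, 0, 0], ![0, 0, 1, 1], ![2, 1, 3, 0], ![1, 2, 0, 2]]

def R33 : Fin 4 → Fin 4 → ℕ :=
  ![![0, 0, 1, 1], ![1, 1, 0, 0], ![1, 1, 2, 0], ![0, 2, 1, 1]]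

def R34 : Fin 4 → Fin 4 → ℕ :=
  ![![0, 2, 0, 1], ![1, 0, 2, 0], ![0, 0, 1, 2], ![2, 1, 0, 0]]

def R35 : Fin 4 → Fin 4 → ℕ :=
  ![![1, 0, 2, 0], ![2, 2, 1, 0], ![0, 1, 0, 1], ![1, 0, 2, 2]]

def R36 : Fin 4 → Fin 4 → ℕ :=
  ![![0, 0, 1, 1], ![0, 2, 1, 0], ![2, 2, 1, 0], ![1, 1, 0, 2]]

end Impossibility

open Impossibility in
/-- The properties of `IsGoodScheme` are incompatible. In the proof, `zero_i_x` and `symm_i_x` state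
that alternative `x` in profile `Ri` gets no probability, or as much as another alternative by
symmetry; `eff_i` follows from efficiency in `Ri`, and `dev_i_j` from the fact that an agent with
true preferences as in `Ri` does not benefit from reporting those that lead to `Rj`. -/
theorem not_isGoodScheme (g : (Fin 4 → Fin 4 → ℕ) → Fin 4 → ℝ) : ¬ IsGoodScheme g := by
  intro hg
  have zero_1_1 : g R1 1 = 0 := hg.eq_zero_of_dominated R1 0 1 (by decide)
  have zero_2_1 : g R2 1 = 0 := hg.eq_zero_of_dominated R2 0 1 (by decide)
  have zero_3_1 : g R3 1 = 0 := hg.eq_zero_of_dominated R3 0 1 (by decide)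
  have zero_6_1 : g R6 1 = 0 := hg.eq_zero_of_dominated R6 0 1 (by decide)
  have zero_7_1 : g R7 1 = 0 := hg.eq_zero_of_dominated R7 0 1 (by decide)
  have symm_8_2 : g R8 2 = g R8 1 := hg.apply_symm R8 ![1, 0, 3, 2] ![3, 2, 1, 0] 1 (by decide)
  have symm_8_3 : g R8 3 = g R8 0 := hg.apply_symm R8 ![1, 0, 3, 2] ![3, 2, 1, 0] 0 (by decide)
  have zero_9_1 : g R9 1 = 0 := hg.eq_zero_of_dominated R9 0 1 (by decide)
  have zero_10_1 : g R10 1 = 0 := hg.eq_zero_of_dominated R10 0 1 (by decide)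
  have zero_11_1 : g R11 1 = 0 := hg.eq_zero_of_dominated R11 0 1 (by decide)
  have zero_12_1 : g R12 1 = 0 := hg.eq_zero_of_dominated R12 0 1 (by decide)
  have zero_13_1 : g R13 1 = 0 := hg.eq_zero_of_dominated R13 0 1 (by decide)
  have zero_14_1 : g R14 1 = 0 := hg.eq_zero_of_dominated R14 0 1 (by decide)
  have zero_16_1 : g R16 1 = 0 := hg.eq_zero_of_dominated R16 0 1 (by decide)
  have zero_18_1 : g R18 1 = 0 := hg.eq_zero_of_dominated R18 0 1 (by decide)
  have symm_21_2 : g R21 2 = g R21 1 := hg.apply_symm R21 ![1, 0, 3, 2] ![0, 2, 1, 3] 1 (by decide)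
  have symm_22_2 : g R22 2 = g R22 1 := hg.apply_symm R22 ![1, 0, 3, 2] ![0, 2, 1, 3] 1 (by decide)
  have symm_23_2 : g R23 2 = g R23 1 := hg.apply_symm R23 ![1, 0, 3, 2] ![3, 2, 1, 0] 1 (by decide)
  have symm_23_3 : g R23 3 = g R23 0 := hg.apply_symm R23 ![1, 0, 3, 2] ![3, 2, 1, 0] 0 (by decide)
  have zero_26_1 : g R26 1 = 0 := hg.eq_zero_of_dominated R26 0 1 (by decide)
  have zero_27_1 : g R27 1 = 0 := hg.eq_zero_of_dominated R27 0 1 (by decide)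
  have symm_29_2 : g R29 2 = g R29 0 := hg.apply_symm R29 ![0, 1, 3, 2] ![2, 3, 0, 1] 0 (by decide)
  have symm_29_3 : g R29 3 = g R29 1 := hg.apply_symm R29 ![0, 1, 3, 2] ![2, 3, 0, 1] 1 (by decide)
  have zero_33_1 : g R33 1 = 0 := hg.eq_zero_of_dominated R33 0 1 (by decide)
  have zero_33_2 : g R33 2 = 0 := hg.eq_zero_of_dominated R33 3 2 (by decide)
  have symm_33_3 : g R33 3 = g R33 0 := hg.apply_symm R33 ![1, 0, 3, 2] ![3, 2, 1, 0] 0 (by decide)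
  have symm_34_1 : g R34 1 = g R34 0 := hg.apply_symm R34 ![3, 2, 0, 1] ![1, 3, 0, 2] 0 (by decide)
  have symm_34_2 : g R34 2 = g R34 0 := hg.apply_symm R34 ![2, 3, 1, 0] ![2, 0, 3, 1] 0 (by decide)
  have symm_34_3 : g R34 3 = g R34 0 := hg.apply_symm R34 ![1, 0, 3, 2] ![3, 2, 1, 0] 0 (by decide)
  have zero_36_1 : g R36 1 = 0 := hg.eq_zero_of_dominated R36 0 1 (by decide)
  have dev_8_28 : g R28 0 + g R28 1 ≤ g R8 0 + g R8 1 :=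
    hg.deviation_two R8 R28 0 ![3, 0, 1, 2] ![0, 1, 2, 3] (by decide)
  have dev_14_2 : g R2 0 + g R2 1 + g R2 2 ≤ g R14 0 + g R14 1 + g R14 2 :=
    hg.deviation_two R14 R2 2 ![0, 1, 2, 3] ![0, 1, 2, 3] (by decide)
  have dev_12_11 : g R11 2 + g R11 3 ≤ g R12 2 + g R12 3 :=
    hg.deviation_two R12 R11 1 ![0, 1, 3, 2] ![0, 1, 3, 2] (by decide)
  have eff_8 : g R8 1 = 0 := by
    rcases hg.eq_zero_or_eq_zero R8 0 1 2 3 (by decide) with h | h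
    · exact h
    · linarith only [h, symm_8_2]
  have dev_10_8 : g R8 0 + g R8 2 + g R8 3 ≤ g R10 0 + g R10 1 + g R10 3 :=
    hg.deviation_two R10 R8 3 ![0, 1, 3, 2] ![3, 2, 1, 0] (by decide)
  have dev_13_9 : g R9 0 + g R9 2 ≤ g R13 0 + g R13 2 :=
    hg.deviation_two R13 R9 2 ![0, 1, 3, 2] ![0, 1, 2, 3] (by decide)
  have dev_14_11 : g R11 0 + g R11 3 ≤ g R14 0 + g R14 3 :=
    hg.deviation_two R14 R11 1 ![0, 3, 2, 1] ![0, 1, 2, 3] (by decide)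
  have dev_32_19 : g R19 0 + g R19 1 ≤ g R32 0 + g R32 1 :=
    hg.deviation_two R32 R19 1 ![0, 3, 1, 2] ![0, 1, 2, 3] (by decide)
  have dev_4_5 : g R5 1 + g R5 3 ≤ g R4 0 + g R4 2 :=
    hg.deviation_two R4 R5 2 ![1, 0, 3, 2] ![3, 2, 1, 0] (by decide)
  have dev_13_1 : g R1 0 + g R1 2 ≤ g R13 0 + g R13 2 :=
    hg.deviation_two R13 R1 2 ![0, 1, 3, 2] ![0, 1, 2, 3] (by decide)
  have dev_27_16 : g R16 0 + g R16 1 + g R16 2 ≤ g R27 0 + g R27 1 + g R27 2 :=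
    hg.deviation_two R27 R16 2 ![0, 3, 2, 1] ![0, 1, 2, 3] (by decide)
  have dev_11_19 : g R19 0 + g R19 2 + g R19 3 ≤ g R11 0 + g R11 1 + g R11 2 :=
    hg.deviation_two R11 R19 2 ![0, 3, 2, 1] ![2, 3, 1, 0] (by decide)
  have dev_3_36 : g R36 2 + g R36 3 ≤ g R3 2 + g R3 3 :=
    hg.deviation_two R3 R36 0 ![2, 0, 1, 3] ![0, 1, 3, 2] (by decide)
  have dev_4_32 : g R32 0 + g R32 2 ≤ g R4 0 + g R4 2 :=
    hg.deviation_two R4 R32 2 ![1, 0, 3, 2] ![0, 1, 2, 3] (by decide)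
  have dev_28_8 : g R8 3 = g R28 0 ∧ g R8 2 + g R8 3 = g R28 0 + g R28 1 := by
    have h : g R8 3 < g R28 0 ∨ g R8 2 + g R8 3 < g R28 0 + g R28 1 ∨ g R8 3 = g R28 0 ∧
        g R8 2 + g R8 3 = g R28 0 + g R28 1 :=
        hg.deviation_three R28 R8 3 ![0, 3, 2, 1] ![3, 2, 1, 0] (by decide)
    rcases h with h | h | h
    · exfalso
      linarith only [h, dev_8_28, hg.nonneg R28 1, eff_8, symm_8_3]
    · exfalso
      linarith only [h, dev_8_28, symm_8_2, symm_8_3]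
    · exact h
  have eff_23 : g R23 1 = 0 := by
    rcases hg.eq_zero_or_eq_zero R23 0 1 2 3 (by decide) with h | h
    · exact h
    · linarith only [h, symm_23_2]
  have dev_36_16 : g R16 0 + g R16 1 ≤ g R36 0 + g R36 1 :=
    hg.deviation_two R36 R16 0 ![3, 0, 1, 2] ![0, 1, 2, 3] (by decide)
  have dev_18_10 : g R10 0 + g R10 2 ≤ g R18 0 + g R18 2 :=
    hg.deviation_two R18 R10 2 ![1, 0, 2, 3] ![0, 1, 2, 3] (by decide)
  have dev_31_24 : g R24 0 + g R24 1 + g R24 3 ≤ g R31 0 + g R31 1 + g R31 2 :=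
    hg.deviation_two R31 R24 2 ![1, 3, 0, 2] ![0, 1, 3, 2] (by decide)
  have dev_18_12 : g R12 0 + g R12 2 ≤ g R18 0 + g R18 2 :=
    hg.deviation_two R18 R12 2 ![0, 1, 2, 3] ![0, 1, 2, 3] (by decide)
  have dev_26_17 : g R17 2 + g R17 3 ≤ g R26 2 + g R26 3 :=
    hg.deviation_two R26 R17 0 ![1, 0, 3, 2] ![0, 1, 2, 3] (by decide)
  have dev_20_22 : g R22 2 + g R22 3 ≤ g R20 2 + g R20 3 :=
    hg.deviation_two R20 R22 0 ![0, 1, 2, 3] ![0, 1, 2, 3] (by decide)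
  have dev_21_20 : g R20 1 + g R20 3 ≤ g R21 1 + g R21 3 :=
    hg.deviation_two R21 R20 0 ![1, 0, 2, 3] ![0, 1, 2, 3] (by decide)
  have dev_7_36 : g R36 0 + g R36 1 + g R36 2 ≤ g R7 0 + g R7 1 + g R7 2 :=
    hg.deviation_two R7 R36 3 ![0, 1, 2, 3] ![0, 1, 2, 3] (by decide)
  have dev_13_33 : g R33 1 + g R33 3 ≤ g R13 0 + g R13 2 :=
    hg.deviation_two R13 R33 2 ![1, 0, 2, 3] ![3, 2, 1, 0] (by decide)
  have dev_3_26 : g R26 0 + g R26 1 ≤ g R3 0 + g R3 1 :=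
    hg.deviation_two R3 R26 1 ![0, 2, 1, 3] ![0, 1, 2, 3] (by decide)
  have dev_10_7 : g R7 2 + g R7 3 ≤ g R10 2 + g R10 3 :=
    hg.deviation_two R10 R7 0 ![2, 0, 1, 3] ![0, 1, 3, 2] (by decide)
  have dev_13_3 : g R3 0 + g R3 2 ≤ g R13 0 + g R13 2 :=
    hg.deviation_two R13 R3 2 ![1, 0, 2, 3] ![0, 1, 2, 3] (by decide)
  have dev_31_30 : g R30 1 + g R30 2 + g R30 3 ≤ g R31 0 + g R31 1 + g R31 2 :=
    hg.deviation_two R31 R30 2 ![3, 0, 1, 2] ![3, 2, 0, 1] (by decide)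
  have dev_7_27 : g R27 0 + g R27 1 ≤ g R7 0 + g R7 1 :=
    hg.deviation_two R7 R27 0 ![1, 0, 3, 2] ![0, 1, 2, 3] (by decide)
  have dev_7_31 : g R31 0 + g R31 1 ≤ g R7 0 + g R7 1 :=
    hg.deviation_two R7 R31 0 ![1, 0, 3, 2] ![0, 1, 2, 3] (by decide)
  have eff_21 : g R21 1 = 0 := by
    rcases hg.eq_zero_or_eq_zero R21 0 1 2 3 (by decide) with h | h
    · exact h
    · linarith only [h, symm_21_2]
  have dev_13_6 : g R6 2 + g R6 3 ≤ g R13 2 + g R13 3 :=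
    hg.deviation_two R13 R6 1 ![0, 3, 1, 2] ![0, 1, 2, 3] (by decide)
  have dev_26_3 : g R3 0 = g R26 0 ∧ g R3 0 + g R3 1 = g R26 0 + g R26 1 := by
    have h : g R3 0 < g R26 0 ∨ g R3 0 + g R3 1 < g R26 0 + g R26 1 ∨ g R3 0 = g R26 0 ∧
        g R3 0 + g R3 1 = g R26 0 + g R26 1 :=
        hg.deviation_three R26 R3 2 ![0, 2, 1, 3] ![0, 1, 2, 3] (by decide)
    rcases h with h | h | h
    · exfalso
      linarith only [h, dev_3_26, zero_3_1, zero_26_1]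
    · exfalso
      linarith only [h, dev_3_26]
    · exact h
  have dev_29_35 : g R35 1 + g R35 3 ≤ g R29 0 + g R29 2 :=
    hg.deviation_two R29 R35 0 ![0, 2, 1, 3] ![3, 2, 1, 0] (by decide)
  have dev_14_7 : g R7 0 + g R7 3 ≤ g R14 0 + g R14 3 :=
    hg.deviation_two R14 R7 1 ![0, 1, 3, 2] ![0, 1, 2, 3] (by decide)
  have dev_35_15 : g R15 0 + g R15 2 ≤ g R35 0 + g R35 2 :=
    hg.deviation_two R35 R15 2 ![0, 3, 2, 1] ![0, 1, 2, 3] (by decide)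
  have dev_13_5 : g R5 0 + g R5 2 ≤ g R13 0 + g R13 2 :=
    hg.deviation_two R13 R5 2 ![0, 1, 2, 3] ![0, 1, 2, 3] (by decide)
  have dev_3_13 : g R13 0 + g R13 2 = g R3 0 + g R3 2 ∧
      g R13 0 + g R13 2 + g R13 3 = g R3 0 + g R3 2 + g R3 3 := by
    have h : g R13 0 + g R13 2 < g R3 0 + g R3 2 ∨
        g R13 0 + g R13 2 + g R13 3 < g R3 0 + g R3 2 + g R3 3 ∨
        g R13 0 + g R13 2 = g R3 0 + g R3 2 ∧
        g R13 0 + g R13 2 + g R13 3 = g R3 0 + g R3 2 + g R3 3 :=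
        hg.deviation_three R3 R13 2 ![1, 0, 2, 3] ![0, 1, 2, 3] (by decide)
    rcases h with h | h | h
    · exfalso
      linarith only [h, dev_13_3]
    · exfalso
      linarith only [h, hg.sum_eq R3, hg.sum_eq R13, zero_3_1, zero_13_1]
    · exact h
  have eff_22 : g R22 1 = 0 := by
    rcases hg.eq_zero_or_eq_zero R22 0 1 2 3 (by decide) with h | h
    · exact h
    · linarith only [h, symm_22_2]
  have dev_2_36 : g R36 0 + g R36 3 ≤ g R2 0 + g R2 3 :=
    hg.deviation_two R2 R36 1 ![0, 1, 3, 2] ![0, 1, 2, 3] (by decide)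
  have dev_10_18 : g R18 0 + g R18 2 = g R10 0 + g R10 2 ∧
      g R18 0 + g R18 2 + g R18 3 = g R10 0 + g R10 2 + g R10 3 := by
    have h : g R18 0 + g R18 2 < g R10 0 + g R10 2 ∨
        g R18 0 + g R18 2 + g R18 3 < g R10 0 + g R10 2 + g R10 3 ∨
        g R18 0 + g R18 2 = g R10 0 + g R10 2 ∧
        g R18 0 + g R18 2 + g R18 3 = g R10 0 + g R10 2 + g R10 3 :=
        hg.deviation_three R10 R18 2 ![1, 0, 2, 3] ![0, 1, 2, 3] (by decide)
    rcases h with h | h | h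
    · exfalso
      linarith only [h, dev_18_10]
    · exfalso
      linarith only [h, hg.sum_eq R18, hg.sum_eq R10, zero_10_1, zero_18_1]
    · exact h
  have dev_27_7 : g R7 0 = g R27 0 ∧ g R7 0 + g R7 1 = g R27 0 + g R27 1 := by
    have h : g R7 0 < g R27 0 ∨ g R7 0 + g R7 1 < g R27 0 + g R27 1 ∨ g R7 0 = g R27 0 ∧
        g R7 0 + g R7 1 = g R27 0 + g R27 1 :=
        hg.deviation_three R27 R7 1 ![1, 0, 3, 2] ![0, 1, 2, 3] (by decide)
    rcases h with h | h | h
    · exfalso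
      linarith only [h, dev_7_27, zero_7_1, zero_27_1]
    · exfalso
      linarith only [h, dev_7_27]
    · exact h
  have dev_20_21 : g R21 1 + g R21 3 = g R20 1 + g R20 3 ∧
      g R21 0 + g R21 1 + g R21 3 = g R20 0 + g R20 1 + g R20 3 := by
    have h : g R21 1 + g R21 3 < g R20 1 + g R20 3 ∨
        g R21 0 + g R21 1 + g R21 3 < g R20 0 + g R20 1 + g R20 3 ∨
        g R21 1 + g R21 3 = g R20 1 + g R20 3 ∧
        g R21 0 + g R21 1 + g R21 3 = g R20 0 + g R20 1 + g R20 3 :=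
        hg.deviation_three R20 R21 1 ![1, 0, 2, 3] ![0, 1, 2, 3] (by decide)
    rcases h with h | h | h
    · exfalso
      linarith only [h, dev_21_20]
    · exfalso
      linarith only [h, hg.sum_eq R20, hg.nonneg R20 2, hg.sum_eq R21, eff_21, symm_21_2]
    · exact h
  have dev_3_8 : g R8 0 = g R3 3 ∧ g R8 0 + g R8 2 + g R8 3 = g R3 0 + g R3 1 + g R3 3 := by
    have h : g R8 0 < g R3 3 ∨ g R8 0 + g R8 2 + g R8 3 < g R3 0 + g R3 1 + g R3 3 ∨
        g R8 0 = g R3 3 ∧ g R8 0 + g R8 2 + g R8 3 = g R3 0 + g R3 1 + g R3 3 :=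
        hg.deviation_three R3 R8 3 ![0, 1, 3, 2] ![3, 2, 1, 0] (by decide)
    rcases h with h | h | h
    · exfalso
      linarith only [h, eff_8, hg.sum_eq R33, hg.sum_eq R3, dev_13_33, hg.sum_eq R8, dev_3_13.1,
        zero_3_1, symm_8_2, symm_8_3, zero_33_1, zero_33_2, symm_33_3]
    · exfalso
      linarith only [h, eff_8, hg.nonneg R3 2, hg.sum_eq R3, hg.sum_eq R8]
    · exact h
  have dev_7_14 : g R14 0 + g R14 3 = g R7 0 + g R7 3 ∧
      g R14 0 + g R14 2 + g R14 3 = g R7 0 + g R7 2 + g R7 3 := by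
    have h : g R14 0 + g R14 3 < g R7 0 + g R7 3 ∨
        g R14 0 + g R14 2 + g R14 3 < g R7 0 + g R7 2 + g R7 3 ∨
        g R14 0 + g R14 3 = g R7 0 + g R7 3 ∧
        g R14 0 + g R14 2 + g R14 3 = g R7 0 + g R7 2 + g R7 3 :=
        hg.deviation_three R7 R14 1 ![0, 1, 3, 2] ![0, 1, 2, 3] (by decide)
    rcases h with h | h | h
    · exfalso
      linarith only [h, dev_14_7]
    · exfalso
      linarith only [h, hg.sum_eq R7, hg.sum_eq R14, zero_7_1, zero_14_1]
    · exact h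
  have dev_17_23 : g R23 3 = g R17 3 ∧
      g R23 0 + g R23 1 + g R23 3 = g R17 0 + g R17 1 + g R17 3 := by
    have h : g R23 3 < g R17 3 ∨ g R23 0 + g R23 1 + g R23 3 < g R17 0 + g R17 1 + g R17 3 ∨
        g R23 3 = g R17 3 ∧ g R23 0 + g R23 1 + g R23 3 = g R17 0 + g R17 1 + g R17 3 :=
        hg.deviation_three R17 R23 2 ![0, 3, 1, 2] ![0, 1, 2, 3] (by decide)
    rcases h with h | h | h
    · exfalso
      linarith only [h, hg.sum_eq R23, eff_23, dev_26_17, hg.sum_eq R26, hg.sum_eq R8,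
        dev_26_3.2, hg.nonneg R17 2, dev_3_8.1, dev_3_8.2, symm_8_2, symm_8_3, symm_23_2,
        symm_23_3]
    · exfalso
      linarith only [h, hg.sum_eq R23, eff_23, hg.sum_eq R17, hg.nonneg R17 2, symm_23_2]
    · exact h
  have dev_29_1 : g R1 3 = g R29 0 ∧ g R1 1 + g R1 3 = g R29 0 + g R29 1 := by
    have h : g R1 3 < g R29 0 ∨ g R1 1 + g R1 3 < g R29 0 + g R29 1 ∨ g R1 3 = g R29 0 ∧
        g R1 1 + g R1 3 = g R29 0 + g R29 1 :=
        hg.deviation_three R29 R1 2 ![1, 0, 2, 3] ![3, 1, 2, 0] (by decide)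
    rcases h with h | h | h
    · exfalso
      linarith only [h, eff_8, dev_13_1, hg.sum_eq R1, hg.sum_eq R3, hg.nonneg R29 1,
        hg.sum_eq R8, hg.sum_eq R29, dev_3_13.1, dev_3_8.1, zero_1_1, zero_3_1, symm_8_2,
        symm_8_3, symm_29_2, symm_29_3]
    · exfalso
      linarith only [h, eff_8, dev_13_1, hg.sum_eq R1, hg.sum_eq R3, hg.sum_eq R8, hg.sum_eq R29,
        dev_3_13.1, dev_3_8.1, zero_3_1, symm_8_2, symm_8_3, symm_29_2, symm_29_3]
    · exact h
  have dev_35_29 : g R29 0 + g R29 2 = g R35 1 + g R35 3 ∧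
      g R29 0 + g R29 2 + g R29 3 = g R35 0 + g R35 1 + g R35 3 := by
    have h : g R29 0 + g R29 2 < g R35 1 + g R35 3 ∨
        g R29 0 + g R29 2 + g R29 3 < g R35 0 + g R35 1 + g R35 3 ∨
        g R29 0 + g R29 2 = g R35 1 + g R35 3 ∧
        g R29 0 + g R29 2 + g R29 3 = g R35 0 + g R35 1 + g R35 3 :=
        hg.deviation_three R35 R29 0 ![0, 2, 1, 3] ![3, 2, 1, 0] (by decide)
    rcases h with h | h | h
    · exfalso
      linarith only [h, dev_29_35]
    · exfalso
      linarith only [h, eff_8, dev_13_1, hg.sum_eq R1, hg.sum_eq R3, hg.sum_eq R35,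
        hg.nonneg R35 2, hg.sum_eq R8, hg.sum_eq R29, dev_3_13.1, dev_3_8.1, dev_29_1.1,
        zero_1_1, zero_3_1, symm_8_2, symm_8_3, symm_29_2, symm_29_3]
    · exact h
  have dev_3_1 : g R1 0 + g R1 2 = g R3 0 + g R3 2 ∧
      g R1 0 + g R1 2 + g R1 3 = g R3 0 + g R3 2 + g R3 3 := by
    have h : g R1 0 + g R1 2 < g R3 0 + g R3 2 ∨
        g R1 0 + g R1 2 + g R1 3 < g R3 0 + g R3 2 + g R3 3 ∨ g R1 0 + g R1 2 = g R3 0 + g R3 2 ∧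
        g R1 0 + g R1 2 + g R1 3 = g R3 0 + g R3 2 + g R3 3 :=
        hg.deviation_three R3 R1 2 ![1, 0, 3, 2] ![0, 1, 2, 3] (by decide)
    rcases h with h | h | h
    · exfalso
      linarith only [h, eff_8, hg.sum_eq R1, hg.sum_eq R3, hg.sum_eq R8, hg.sum_eq R29,
        dev_3_8.1, dev_29_1.2, zero_3_1, symm_8_2, symm_8_3, symm_29_2, symm_29_3]
    · exfalso
      linarith only [h, hg.sum_eq R1, hg.sum_eq R3, zero_1_1, zero_3_1]
    · exact h
  have dev_15_16 : g R16 2 = g R15 0 ∧ g R16 1 + g R16 2 = g R15 0 + g R15 2 := by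
    have h : g R16 2 < g R15 0 ∨ g R16 1 + g R16 2 < g R15 0 + g R15 2 ∨ g R16 2 = g R15 0 ∧
        g R16 1 + g R16 2 = g R15 0 + g R15 2 :=
        hg.deviation_three R15 R16 2 ![0, 1, 2, 3] ![3, 2, 0, 1] (by decide)
    rcases h with h | h | h
    · exfalso
      linarith only [h, hg.nonneg R15 2, eff_8, hg.nonneg R16 2, hg.sum_eq R35, hg.sum_eq R8,
        dev_35_15, dev_3_8.1, dev_29_1.1, dev_35_29.1, dev_3_1.1, dev_3_1.2, symm_8_2, symm_8_3,
        symm_29_2]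
    · exfalso
      linarith only [h, eff_8, hg.nonneg R16 2, hg.sum_eq R35, hg.sum_eq R8, dev_35_15,
        dev_3_8.1, dev_29_1.1, dev_35_29.1, dev_3_1.1, dev_3_1.2, symm_8_2, symm_8_3, zero_16_1,
        symm_29_2]
    · exact h
  have dev_16_27 : g R27 2 = g R16 2 ∧
      g R27 0 + g R27 1 + g R27 2 = g R16 0 + g R16 1 + g R16 2 := by
    have h : g R27 2 < g R16 2 ∨ g R27 0 + g R27 1 + g R27 2 < g R16 0 + g R16 1 + g R16 2 ∨
        g R27 2 = g R16 2 ∧ g R27 0 + g R27 1 + g R27 2 = g R16 0 + g R16 1 + g R16 2 :=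
        hg.deviation_three R16 R27 2 ![0, 3, 2, 1] ![0, 1, 2, 3] (by decide)
    rcases h with h | h | h
    · exfalso
      linarith only [h, hg.nonneg R15 2, eff_8, hg.nonneg R27 2, hg.sum_eq R35, hg.sum_eq R8,
        dev_35_15, dev_3_8.1, dev_29_1.1, dev_35_29.1, dev_3_1.1, dev_3_1.2, dev_15_16.1,
        symm_8_2, symm_8_3, symm_29_2]
    · exfalso
      linarith only [h, dev_27_16]
    · exact h
  have dev_2_14 : g R14 2 = g R2 2 ∧ g R14 0 + g R14 1 + g R14 2 = g R2 0 + g R2 1 + g R2 2 := by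
    have h : g R14 2 < g R2 2 ∨ g R14 0 + g R14 1 + g R14 2 < g R2 0 + g R2 1 + g R2 2 ∨
        g R14 2 = g R2 2 ∧ g R14 0 + g R14 1 + g R14 2 = g R2 0 + g R2 1 + g R2 2 :=
        hg.deviation_three R2 R14 2 ![0, 1, 2, 3] ![0, 1, 2, 3] (by decide)
    rcases h with h | h | h
    · exfalso
      linarith only [h, dev_36_16, hg.sum_eq R36, dev_7_36, hg.sum_eq R2, dev_2_36, dev_27_7.2,
        dev_7_14.1, dev_7_14.2, dev_16_27.1, dev_16_27.2, zero_2_1, zero_36_1]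
    · exfalso
      linarith only [h, dev_14_2]
    · exact h
  have dev_31_27 : g R27 0 + g R27 1 = g R31 0 + g R31 1 ∧
      g R27 0 + g R27 1 + g R27 3 = g R31 0 + g R31 1 + g R31 3 := by
    have h : g R27 0 + g R27 1 < g R31 0 + g R31 1 ∨
        g R27 0 + g R27 1 + g R27 3 < g R31 0 + g R31 1 + g R31 3 ∨
        g R27 0 + g R27 1 = g R31 0 + g R31 1 ∧
        g R27 0 + g R27 1 + g R27 3 = g R31 0 + g R31 1 + g R31 3 :=
        hg.deviation_three R31 R27 1 ![0, 1, 2, 3] ![0, 1, 2, 3] (by decide)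
    rcases h with h | h | h
    · exfalso
      linarith only [h, dev_7_31, dev_27_7.2]
    · exfalso
      linarith only [h, hg.nonneg R15 2, hg.nonneg R31 2, eff_8, hg.sum_eq R31, hg.sum_eq R27,
        hg.sum_eq R35, hg.sum_eq R8, dev_35_15, dev_3_8.1, dev_29_1.1, dev_35_29.1, dev_3_1.1,
        dev_3_1.2, dev_15_16.1, dev_16_27.1, symm_8_2, symm_8_3, symm_29_2]
    · exact h
  have h : g R21 0 < g R6 3 ∨ g R21 0 + g R21 2 + g R21 3 < g R6 0 + g R6 1 + g R6 3 ∨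
      g R21 0 = g R6 3 ∧ g R21 0 + g R21 2 + g R21 3 = g R6 0 + g R6 1 + g R6 3 :=
    hg.deviation_three R6 R21 2 ![1, 0, 3, 2] ![3, 2, 1, 0] (by decide)
  rcases h with dev_6_21 | h | dev_6_21
  · have h : g R6 3 < g R21 0 ∨ g R6 1 + g R6 3 < g R21 0 + g R21 1 ∨ g R6 3 = g R21 0 ∧
        g R6 1 + g R6 3 = g R21 0 + g R21 1 :=
      hg.deviation_three R21 R6 2 ![0, 1, 2, 3] ![3, 1, 2, 0] (by decide)
    rcases h with h | h | h
    · linarith only [h, dev_6_21]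
    · linarith only [h, eff_21, dev_6_21, zero_6_1]
    · linarith only [h.1, dev_6_21]
  · linarith only [h, hg.sum_eq R6, hg.nonneg R6 2, hg.sum_eq R21, eff_21]
  · have h : g R17 0 + g R17 1 < g R25 0 + g R25 1 ∨
        g R17 0 + g R17 1 + g R17 3 < g R25 0 + g R25 1 + g R25 3 ∨
        g R17 0 + g R17 1 = g R25 0 + g R25 1 ∧
        g R17 0 + g R17 1 + g R17 3 = g R25 0 + g R25 1 + g R25 3 :=
      hg.deviation_three R25 R17 3 ![0, 1, 2, 3] ![0, 1, 2, 3] (by decide)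
    rcases h with dev_25_17 | h | dev_25_17
    · have h : g R22 0 < g R25 3 ∨ g R22 0 + g R22 2 + g R22 3 < g R25 0 + g R25 1 + g R25 3 ∨
          g R22 0 = g R25 3 ∧ g R22 0 + g R22 2 + g R22 3 = g R25 0 + g R25 1 + g R25 3 :=
        hg.deviation_three R25 R22 2 ![1, 2, 3, 0] ![3, 2, 1, 0] (by decide)
      rcases h with dev_25_22 | h | dev_25_22
      · have h : g R28 0 < g R20 0 ∨ g R28 0 + g R28 2 < g R20 0 + g R20 2 ∨ g R28 0 = g R20 0 ∧
            g R28 0 + g R28 2 = g R20 0 + g R20 2 :=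
          hg.deviation_three R20 R28 3 ![0, 2, 3, 1] ![0, 1, 2, 3] (by decide)
        rcases h with h | h | h
        · linarith only [h, hg.sum_eq R25, hg.sum_eq R20, eff_8, dev_28_8.1, hg.nonneg R25 2,
            hg.nonneg R20 1, dev_26_17, dev_20_22, hg.sum_eq R17, hg.sum_eq R22, hg.sum_eq R26,
            hg.sum_eq R8, dev_26_3.2, eff_22, dev_3_8.1, dev_3_8.2, dev_25_17, dev_25_22,
            symm_8_3]
        · linarith only [h, hg.sum_eq R25, hg.sum_eq R20, eff_8, dev_28_8.1, hg.nonneg R25 2,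
            hg.nonneg R20 1, dev_26_17, dev_20_22, hg.sum_eq R21, hg.sum_eq R17, hg.nonneg R28 2,
            hg.sum_eq R22, hg.sum_eq R26, eff_21, hg.sum_eq R8, dev_26_3.2, eff_22, dev_20_21.2,
            dev_3_8.1, dev_3_8.2, dev_25_17, dev_25_22, symm_8_3, symm_21_2]
        · linarith only [h.1, hg.sum_eq R25, hg.sum_eq R20, eff_8, dev_28_8.1, hg.nonneg R25 2,
            hg.nonneg R20 1, dev_26_17, dev_20_22, hg.sum_eq R17, hg.sum_eq R22, hg.sum_eq R26,
            hg.sum_eq R8, dev_26_3.2, eff_22, dev_3_8.1, dev_3_8.2, dev_25_17, dev_25_22,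
            symm_8_3]
      · linarith only [h, hg.sum_eq R25, hg.nonneg R25 2, hg.sum_eq R22, eff_22]
      · have h : g R28 0 < g R20 0 ∨ g R28 0 + g R28 2 < g R20 0 + g R20 2 ∨ g R28 0 = g R20 0 ∧
            g R28 0 + g R28 2 = g R20 0 + g R20 2 :=
          hg.deviation_three R20 R28 3 ![0, 2, 3, 1] ![0, 1, 2, 3] (by decide)
        rcases h with h | h | h
        · linarith only [h, hg.sum_eq R20, eff_8, dev_28_8.1, hg.nonneg R20 1, dev_26_17,
            dev_20_22, hg.sum_eq R17, hg.sum_eq R26, hg.sum_eq R8, dev_26_3.2, dev_3_8.1,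
            dev_3_8.2, dev_25_17, dev_25_22.1, dev_25_22.2, symm_8_3]
        · linarith only [h, hg.sum_eq R20, eff_8, dev_28_8.1, hg.nonneg R20 1, dev_26_17,
            dev_20_22, hg.sum_eq R21, hg.sum_eq R17, hg.nonneg R28 2, hg.sum_eq R26, eff_21,
            hg.sum_eq R8, dev_26_3.2, dev_20_21.2, dev_3_8.1, dev_3_8.2, dev_25_17, dev_25_22.1,
            dev_25_22.2, symm_8_3, symm_21_2]
        · linarith only [h.1, hg.sum_eq R20, eff_8, dev_28_8.1, hg.nonneg R20 1, dev_26_17,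
            dev_20_22, hg.sum_eq R17, hg.sum_eq R26, hg.sum_eq R8, dev_26_3.2, dev_3_8.1,
            dev_3_8.2, dev_25_17, dev_25_22.1, dev_25_22.2, symm_8_3]
    · linarith only [h, hg.sum_eq R25, hg.sum_eq R23, eff_23, hg.nonneg R25 2, dev_17_23.2,
        symm_23_2]
    · have h : g R22 0 < g R25 3 ∨ g R22 0 + g R22 2 + g R22 3 < g R25 0 + g R25 1 + g R25 3 ∨
          g R22 0 = g R25 3 ∧ g R22 0 + g R22 2 + g R22 3 = g R25 0 + g R25 1 + g R25 3 :=
        hg.deviation_three R25 R22 2 ![1, 2, 3, 0] ![3, 2, 1, 0] (by decide)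
      rcases h with dev_25_22 | h | dev_25_22
      · have h : g R28 0 < g R20 0 ∨ g R28 0 + g R28 2 < g R20 0 + g R20 2 ∨ g R28 0 = g R20 0 ∧
            g R28 0 + g R28 2 = g R20 0 + g R20 2 :=
          hg.deviation_three R20 R28 3 ![0, 2, 3, 1] ![0, 1, 2, 3] (by decide)
        rcases h with h | h | h
        · linarith only [h, hg.sum_eq R25, hg.sum_eq R20, eff_8, dev_28_8.1, hg.nonneg R25 2,
            hg.nonneg R20 1, dev_26_17, dev_20_22, hg.sum_eq R17, hg.sum_eq R22, hg.sum_eq R26,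
            hg.sum_eq R8, dev_26_3.2, eff_22, dev_3_8.1, dev_3_8.2, dev_25_17.1, dev_25_22,
            symm_8_3]
        · linarith only [h, hg.sum_eq R25, hg.sum_eq R20, eff_8, dev_28_8.1, hg.nonneg R25 2,
            hg.nonneg R20 1, dev_26_17, dev_20_22, hg.sum_eq R21, hg.sum_eq R17, hg.nonneg R28 2,
            hg.sum_eq R22, hg.sum_eq R26, eff_21, hg.sum_eq R8, dev_26_3.2, eff_22, dev_20_21.2,
            dev_3_8.1, dev_3_8.2, dev_25_17.1, dev_25_22, symm_8_3, symm_21_2]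
        · linarith only [h.1, hg.sum_eq R25, hg.sum_eq R20, eff_8, dev_28_8.1, hg.nonneg R25 2,
            hg.nonneg R20 1, dev_26_17, dev_20_22, hg.sum_eq R17, hg.sum_eq R22, hg.sum_eq R26,
            hg.sum_eq R8, dev_26_3.2, eff_22, dev_3_8.1, dev_3_8.2, dev_25_17.1, dev_25_22,
            symm_8_3]
      · linarith only [h, hg.sum_eq R25, hg.nonneg R25 2, hg.sum_eq R22, eff_22]
      · have dev_6_13 : g R13 3 = g R6 3 ∧ g R13 2 + g R13 3 = g R6 2 + g R6 3 := by
          have h : g R13 3 < g R6 3 ∨ g R13 2 + g R13 3 < g R6 2 + g R6 3 ∨ g R13 3 = g R6 3 ∧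
              g R13 2 + g R13 3 = g R6 2 + g R6 3 :=
              hg.deviation_three R6 R13 3 ![0, 2, 3, 1] ![0, 1, 2, 3] (by decide)
          rcases h with h | h | h
          · exfalso
            linarith only [h, hg.sum_eq R20, eff_8, hg.nonneg R20 1, dev_26_17, dev_20_22,
              dev_21_20, hg.sum_eq R17, hg.sum_eq R26, hg.sum_eq R8, dev_26_3.2, dev_3_13.1,
              dev_3_13.2, dev_20_21.2, dev_3_8.2, dev_6_21.1, dev_25_17.1, dev_25_22.1,
              dev_25_22.2]
          · exfalso
            linarith only [h, dev_13_6]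
          · exact h
        have dev_4_13 : g R13 3 = g R4 3 ∧ g R13 1 + g R13 3 = g R4 1 + g R4 3 ∧
            g R13 0 + g R13 1 + g R13 3 = g R4 0 + g R4 1 + g R4 3 := by
          have h : g R13 3 < g R4 3 ∨ g R13 1 + g R13 3 < g R4 1 + g R4 3 ∨
              g R13 0 + g R13 1 + g R13 3 < g R4 0 + g R4 1 + g R4 3 ∨ g R13 3 = g R4 3 ∧
              g R13 1 + g R13 3 = g R4 1 + g R4 3 ∧
              g R13 0 + g R13 1 + g R13 3 = g R4 0 + g R4 1 + g R4 3 :=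
              hg.deviation_four R4 R13 3 ![0, 1, 2, 3] ![0, 1, 2, 3] (by decide)
          rcases h with h | h | h | h
          · exfalso
            linarith only [h, hg.nonneg R4 1, eff_8, dev_4_5, hg.sum_eq R3, hg.sum_eq R5,
              hg.sum_eq R8, dev_13_5, dev_3_13.1, dev_3_13.2, hg.sum_eq R4, dev_3_8.1, zero_3_1,
              symm_8_2, symm_8_3]
          · exfalso
            linarith only [h, eff_8, dev_4_5, hg.sum_eq R3, hg.sum_eq R13, hg.sum_eq R5,
              hg.sum_eq R8, dev_13_5, dev_3_13.1, hg.sum_eq R4, dev_3_8.1, zero_3_1, symm_8_2,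
              symm_8_3]
          · exfalso
            linarith only [h, hg.sum_eq R20, eff_8, hg.sum_eq R6, hg.nonneg R4 2, hg.sum_eq R13,
              hg.nonneg R20 1, dev_26_17, dev_20_22, hg.sum_eq R21, dev_21_20, hg.sum_eq R17,
              hg.sum_eq R26, eff_21, hg.sum_eq R8, dev_26_3.2, dev_3_13.1, dev_3_13.2,
              hg.sum_eq R4, dev_20_21.2, dev_3_8.2, dev_6_21.1, dev_6_21.2, dev_25_17.1,
              dev_25_22.1, dev_25_22.2, dev_6_13.2]
          · exact h
        have dev_32_9 : g R9 3 = g R32 2 ∧ g R9 1 + g R9 3 = g R32 0 + g R32 2 := by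
          have h : g R9 3 < g R32 2 ∨ g R9 1 + g R9 3 < g R32 0 + g R32 2 ∨ g R9 3 = g R32 2 ∧
              g R9 1 + g R9 3 = g R32 0 + g R32 2 :=
              hg.deviation_three R32 R9 3 ![1, 0, 3, 2] ![1, 0, 3, 2] (by decide)
          rcases h with h | h | h
          · exfalso
            linarith only [h, hg.nonneg R4 1, eff_8, dev_13_9, hg.nonneg R32 0, dev_4_32,
              hg.sum_eq R13, hg.sum_eq R9, hg.sum_eq R8, dev_3_13.1, dev_3_13.2, hg.sum_eq R4,
              dev_3_8.1, dev_4_13.1, dev_4_13.2.1, symm_8_2, symm_8_3, zero_9_1]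
          · exfalso
            linarith only [h, hg.nonneg R4 1, eff_8, dev_13_9, dev_4_32, hg.sum_eq R13,
              hg.sum_eq R9, hg.sum_eq R8, dev_3_13.1, dev_3_13.2, hg.sum_eq R4, dev_3_8.1,
              dev_4_13.1, dev_4_13.2.1, symm_8_2, symm_8_3]
          · exact h
        have h : g R12 2 < g R11 3 ∨ g R12 2 + g R12 3 < g R11 2 + g R11 3 ∨ g R12 2 = g R11 3 ∧
            g R12 2 + g R12 3 = g R11 2 + g R11 3 :=
          hg.deviation_three R11 R12 1 ![0, 1, 3, 2] ![0, 1, 3, 2] (by decide)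
        rcases h with dev_11_12 | h | dev_11_12
        · have h : g R1 3 < g R32 3 ∨ g R1 1 + g R1 3 < g R32 1 + g R32 3 ∨
              g R1 0 + g R1 1 + g R1 3 < g R32 0 + g R32 1 + g R32 3 ∨ g R1 3 = g R32 3 ∧
              g R1 1 + g R1 3 = g R32 1 + g R32 3 ∧
              g R1 0 + g R1 1 + g R1 3 = g R32 0 + g R32 1 + g R32 3 :=
            hg.deviation_four R32 R1 2 ![1, 0, 2, 3] ![0, 1, 2, 3] (by decide)
          rcases h with h | h | h | h
          · linarith only [h, eff_8, dev_13_9, dev_32_19, hg.sum_eq R19, dev_11_19, hg.sum_eq R1,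
              hg.sum_eq R9, hg.sum_eq R11, hg.nonneg R12 2, hg.nonneg R19 0, hg.sum_eq R32,
              hg.sum_eq R8, dev_3_13.1, dev_3_8.1, dev_3_1.1, dev_3_1.2, dev_32_9.1, dev_11_12,
              zero_1_1, symm_8_2, symm_8_3, zero_9_1]
          · linarith only [h, eff_8, dev_13_9, hg.sum_eq R1, hg.sum_eq R9, hg.sum_eq R32,
              hg.sum_eq R8, dev_3_13.1, dev_3_8.1, dev_3_1.1, dev_3_1.2, dev_32_9.2, zero_1_1,
              symm_8_2, symm_8_3]
          · linarith only [h, eff_8, dev_13_9, hg.sum_eq R1, hg.sum_eq R9, hg.nonneg R1 0,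
              hg.sum_eq R32, hg.sum_eq R8, dev_3_13.1, dev_3_8.1, dev_3_1.1, dev_3_1.2,
              dev_32_9.1, zero_1_1, symm_8_2, symm_8_3, zero_9_1]
          · linarith only [h.1, h.2.1, eff_8, dev_13_9, dev_32_19, hg.sum_eq R19, dev_11_19,
              hg.sum_eq R1, hg.sum_eq R9, hg.sum_eq R11, hg.nonneg R12 2, hg.nonneg R19 0,
              hg.sum_eq R32, hg.sum_eq R8, dev_3_13.1, dev_3_8.1, dev_3_1.1, dev_3_1.2,
              dev_32_9.1, dev_32_9.2, dev_11_12, symm_8_2, symm_8_3, zero_9_1]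
        · linarith only [h, dev_12_11]
        · have dev_11_7 : g R7 0 = g R11 0 ∧ g R7 0 + g R7 3 = g R11 0 + g R11 3 ∧
              g R7 0 + g R7 2 + g R7 3 = g R11 0 + g R11 2 + g R11 3 := by
            have h : g R7 0 < g R11 0 ∨ g R7 0 + g R7 3 < g R11 0 + g R11 3 ∨
                g R7 0 + g R7 2 + g R7 3 < g R11 0 + g R11 2 + g R11 3 ∨ g R7 0 = g R11 0 ∧
                g R7 0 + g R7 3 = g R11 0 + g R11 3 ∧
                g R7 0 + g R7 2 + g R7 3 = g R11 0 + g R11 2 + g R11 3 :=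
                hg.deviation_four R11 R7 3 ![0, 2, 3, 1] ![0, 1, 2, 3] (by decide)
            rcases h with h | h | h | h
            · exfalso
              linarith only [h, eff_8, dev_10_8, dev_18_12, hg.sum_eq R11, hg.nonneg R12 2,
                hg.sum_eq R10, dev_10_7, hg.sum_eq R8, hg.sum_eq R7, hg.sum_eq R12, dev_10_18.1,
                dev_11_12.2, zero_7_1, zero_10_1, zero_11_1, zero_12_1]
            · exfalso
              linarith only [h, dev_14_11, dev_7_14.1]
            · exfalso
              linarith only [h, hg.sum_eq R11, hg.sum_eq R7, zero_7_1, zero_11_1]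
            · exact h
          have dev_36_3 : g R3 2 = g R36 3 ∧ g R3 2 + g R3 3 = g R36 2 + g R36 3 := by
            have h : g R3 2 < g R36 3 ∨ g R3 2 + g R3 3 < g R36 2 + g R36 3 ∨ g R3 2 = g R36 3 ∧
                g R3 2 + g R3 3 = g R36 2 + g R36 3 :=
                hg.deviation_three R36 R3 2 ![1, 2, 0, 3] ![0, 1, 3, 2] (by decide)
            rcases h with h | h | h
            · exfalso
              linarith only [h, dev_10_8, dev_36_16, hg.sum_eq R3, dev_18_12, hg.sum_eq R10,
                dev_10_7, hg.sum_eq R2, hg.sum_eq R7, hg.sum_eq R12, dev_2_36, dev_10_18.1,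
                dev_27_7.2, dev_3_8.2, dev_7_14.1, dev_7_14.2, dev_16_27.1, dev_16_27.2,
                dev_2_14.1, dev_11_12.1, dev_11_12.2, dev_11_7.2.1, dev_11_7.2.2, zero_2_1,
                zero_10_1, zero_12_1, zero_36_1]
            · exfalso
              linarith only [h, dev_3_36]
            · exact h
          have dev_22_30 : g R30 0 = g R22 0 ∧ g R30 0 + g R30 2 = g R22 0 + g R22 1 := by
            have h : g R30 0 < g R22 0 ∨ g R30 0 + g R30 2 < g R22 0 + g R22 1 ∨ g R30 0 = g R22 0 ∧
                g R30 0 + g R30 2 = g R22 0 + g R22 1 :=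
                hg.deviation_three R22 R30 2 ![1, 0, 3, 2] ![0, 2, 1, 3] (by decide)
            rcases h with h | h | h
            · exfalso
              linarith only [h, hg.sum_eq R25, hg.nonneg R15 2, eff_8, hg.sum_eq R31, dev_36_16,
                hg.nonneg R25 2, hg.sum_eq R3, hg.sum_eq R27, hg.sum_eq R36, dev_26_17,
                hg.sum_eq R17, hg.sum_eq R35, dev_31_30, hg.sum_eq R26, hg.sum_eq R8, dev_26_3.2,
                dev_35_15, hg.sum_eq R30, dev_3_8.1, dev_29_1.1, dev_35_29.1, dev_3_1.1,
                dev_3_1.2, dev_15_16.1, dev_16_27.2, dev_31_27.1, dev_31_27.2, dev_25_17.1,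
                dev_25_22.1, dev_36_3.2, symm_8_2, symm_8_3, symm_29_2]
            · exfalso
              linarith only [h, hg.sum_eq R25, hg.nonneg R15 2, eff_8, hg.nonneg R30 2,
                hg.sum_eq R31, dev_36_16, hg.nonneg R25 2, hg.sum_eq R3, hg.sum_eq R27,
                hg.sum_eq R36, dev_26_17, hg.sum_eq R17, hg.sum_eq R35, dev_31_30, hg.sum_eq R26,
                hg.sum_eq R8, dev_26_3.2, dev_35_15, hg.sum_eq R30, eff_22, dev_3_8.1,
                dev_29_1.1, dev_35_29.1, dev_3_1.1, dev_3_1.2, dev_15_16.1, dev_16_27.2,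
                dev_31_27.1, dev_31_27.2, dev_25_17.1, dev_25_22.1, dev_36_3.2, symm_8_2,
                symm_8_3, symm_29_2]
            · exact h
          have dev_24_30 : g R30 1 + g R30 3 = g R24 1 + g R24 3 ∧
              g R30 1 + g R30 2 + g R30 3 = g R24 0 + g R24 1 + g R24 3 := by
            have h : g R30 1 + g R30 3 < g R24 1 + g R24 3 ∨
                g R30 1 + g R30 2 + g R30 3 < g R24 0 + g R24 1 + g R24 3 ∨
                g R30 1 + g R30 3 = g R24 1 + g R24 3 ∧
                g R30 1 + g R30 2 + g R30 3 = g R24 0 + g R24 1 + g R24 3 :=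
                hg.deviation_three R24 R30 0 ![1, 3, 2, 0] ![2, 3, 0, 1] (by decide)
            rcases h with h | h | h
            · exfalso
              linarith only [h, hg.sum_eq R25, hg.nonneg R15 2, eff_8, hg.sum_eq R31, dev_36_16,
                hg.nonneg R25 2, hg.sum_eq R3, hg.sum_eq R27, dev_31_24, hg.sum_eq R36,
                dev_26_17, hg.sum_eq R17, hg.sum_eq R35, hg.sum_eq R26, hg.sum_eq R8, dev_26_3.2,
                dev_35_15, hg.sum_eq R30, hg.nonneg R24 0, eff_22, dev_3_8.1, dev_29_1.1,
                dev_35_29.1, dev_3_1.1, dev_3_1.2, dev_15_16.1, dev_16_27.2, dev_31_27.1,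
                dev_31_27.2, dev_25_17.1, dev_25_22.1, dev_36_3.2, dev_22_30.2, symm_8_2,
                symm_8_3, symm_29_2]
            · exfalso
              linarith only [h, hg.sum_eq R25, hg.nonneg R15 2, eff_8, hg.nonneg R30 2,
                hg.sum_eq R31, dev_36_16, hg.nonneg R25 2, hg.sum_eq R3, hg.sum_eq R27,
                dev_31_24, hg.sum_eq R36, dev_26_17, hg.sum_eq R17, hg.sum_eq R35, hg.sum_eq R26,
                hg.sum_eq R8, dev_26_3.2, dev_35_15, hg.sum_eq R30, eff_22, dev_3_8.1,
                dev_29_1.1, dev_35_29.1, dev_3_1.1, dev_3_1.2, dev_15_16.1, dev_16_27.2,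
                dev_31_27.1, dev_31_27.2, dev_25_17.1, dev_25_22.1, dev_36_3.2, dev_22_30.2,
                symm_8_2, symm_8_3, symm_29_2]
            · exact h
          have h : g R24 2 + g R24 3 < g R34 0 + g R34 2 ∨
              g R24 1 + g R24 2 + g R24 3 < g R34 0 + g R34 2 + g R34 3 ∨
              g R24 2 + g R24 3 = g R34 0 + g R34 2 ∧
              g R24 1 + g R24 2 + g R24 3 = g R34 0 + g R34 2 + g R34 3 :=
            hg.deviation_three R34 R24 0 ![2, 3, 1, 0] ![1, 3, 0, 2] (by decide)
          rcases h with h | h | h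
          · linarith only [h, hg.nonneg R15 2, hg.sum_eq R34, eff_8, hg.sum_eq R31, dev_36_16,
              hg.sum_eq R3, hg.sum_eq R27, dev_31_24, hg.sum_eq R36, hg.sum_eq R24,
              hg.sum_eq R35, hg.nonneg R24 3, hg.sum_eq R8, dev_35_15, dev_3_8.1, dev_3_8.2,
              dev_29_1.1, dev_35_29.1, dev_3_1.1, dev_3_1.2, dev_15_16.1, dev_16_27.2,
              dev_31_27.1, dev_31_27.2, dev_36_3.2, symm_8_2, symm_8_3, symm_29_2, symm_34_1,
              symm_34_2, symm_34_3]
          · linarith only [h, hg.sum_eq R34, hg.sum_eq R24, eff_22, dev_22_30.1, dev_22_30.2,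
              dev_24_30.1, dev_24_30.2, symm_34_1, symm_34_2, symm_34_3]
          · linarith only [h.2, hg.sum_eq R34, hg.sum_eq R24, eff_22, dev_22_30.1, dev_22_30.2,
              dev_24_30.1, dev_24_30.2, symm_34_1, symm_34_2, symm_34_3]

/-- **Theorem 1.** There is no anonymous, neutral, sd-efficient, and sd-strategyproof
social decision scheme extending random dictatorship to the full domain of weak
preferences when there are `n ≥ 4` agents and `m ≥ 4` alternatives. -/
theorem no_good_rd_extension {A : Type*} [Fintype A] {n : ℕ}
    (hn : 4 ≤ n) (hm : 4 ≤ Fintype.card A) :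
    ¬ ∃ f : (Fin n → A → A → Prop) → (A → ℝ),
        IsSDS f ∧ Anonymous f ∧ Neutral f ∧ SDEfficient f ∧ SDStrategyproof f ∧
          ExtendsRD f := by
  rintro ⟨f, hf, hanon, hneut, heff, hsp, -⟩
  obtain ⟨e⟩ : Nonempty (Fin 4 ↪ A) := Function.Embedding.nonempty_of_card_le (by simpa using hm)
  exact not_isGoodScheme _
    (isGoodScheme_extendProfile (Fin.castLEEmb hn) e hf hanon hneut heff hsp)
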